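/- arXiv:2404.06268 — 2 statements merged into one kernel-verified Lean document; each statement's English description precedes it below -/
import Mathlib

section
/- Let λ⃗, μ⃗ ∈ 𝒫_{m,ℓ} with ‖λ⃗‖ = ‖μ⃗‖, and let λ ∈ ℤ^{nℓ} be obtained from λ⃗^{tot} by applying some element of 𝔖 (i.e. λ agrees with λ⃗^{tot} up to a permutation of coordinates within each block of n consecutive coordinates). If μ⃗^{tot} ∈ λ + ℤ^{nℓ}_+, then μ⃗ ⊴ λ⃗. -/
noncomputable section

/-- A partition with at most n parts: a weakly decreasing function Fin n → ℕ. -/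
def IsPartitionFn (n : ℕ) (f : Fin n → ℕ) : Prop :=
  ∀ a b : Fin n, a ≤ b → f b ≤ f a

/-- An ℓ-partition of m with components having at most n parts. -/
def IsLPartition (n ℓ m : ℕ) (L : Fin ℓ → Fin n → ℕ) : Prop :=
  (∀ i, IsPartitionFn n (L i)) ∧ (∑ i, ∑ j, L i j) = m

/-- λ⃗^{tot} : the concatenation (λ^{(1)}_n,…,λ^{(1)}_1,…,λ^{(ℓ)}_n,…,λ^{(ℓ)}_1). -/
def tot (n ℓ : ℕ) (L : Fin ℓ → Fin n → ℕ) (i : Fin (n * ℓ)) : ℕ :=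
  L ⟨(i : ℕ) / n, Nat.div_lt_of_lt_mul i.isLt⟩
    ⟨n - 1 - (i : ℕ) % n, by
      have hn : 0 < n := by
        rcases Nat.eq_zero_or_pos n with h | h
        · subst h; exact absurd i.isLt (by simp)
        · exact h
      exact lt_of_le_of_lt (Nat.sub_le _ _) (Nat.sub_lt hn Nat.one_pos)⟩

/-- All nℓ parts of λ⃗ sorted decreasingly; encodes ‖λ⃗‖ (padded by zeros). -/
def sortedDesc (n ℓ : ℕ) (L : Fin ℓ → Fin n → ℕ) : List ℕ :=
  (((Finset.univ : Finset (Fin ℓ × Fin n)).val.map fun p => L p.1 p.2).sort (· ≤ ·)).reverse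

/-- Dominance comparison via partial sums of the decreasing lists. -/
def domListLE (l₁ l₂ : List ℕ) : Prop :=
  ∀ k : ℕ, (l₁.take k).sum ≤ (l₂.take k).sum

/-- ℤ^{N}_+ : nonzero integer vectors with coordinate sum 0 and all initial partial
sums ≥ 0 (equivalently, nonzero elements of the ℤ_{≥0}-span of the ε_i − ε_j, i < j). -/
def Zplus (N : ℕ) : Set (Fin N → ℤ) :=
  {v | v ≠ 0 ∧ (∑ i, v i) = 0 ∧
    ∀ t : ℕ, 0 ≤ ∑ i : Fin N, if (i : ℕ) < t then v i else 0}

/-- λ⃗ ⊲ μ⃗ iff ‖λ⃗‖ < ‖μ⃗‖ in dominance, or ‖λ⃗‖ = ‖μ⃗‖ and λ⃗^{tot} − μ⃗^{tot} ∈ ℤ^{nℓ}_+. -/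
def lhd (n ℓ : ℕ) (L M : Fin ℓ → Fin n → ℕ) : Prop :=
  (domListLE (sortedDesc n ℓ L) (sortedDesc n ℓ M) ∧ sortedDesc n ℓ L ≠ sortedDesc n ℓ M) ∨
  (sortedDesc n ℓ L = sortedDesc n ℓ M ∧
    (fun i => (tot n ℓ L i : ℤ) - (tot n ℓ M i : ℤ)) ∈ Zplus (n * ℓ))

/-- λ⃗ ⊴ μ⃗. -/
def lhdEq (n ℓ : ℕ) (L M : Fin ℓ → Fin n → ℕ) : Prop :=
  lhd n ℓ L M ∨ L = M

theorem tot_le_tot {n ℓ : ℕ} {L : Fin ℓ → Fin n → ℕ} (hL : ∀ i, IsPartitionFn n (L i))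
    {i j : Fin (n * ℓ)} (hij : (i : ℕ) ≤ j) (hdiv : (i : ℕ) / n = (j : ℕ) / n) :
    tot n ℓ L i ≤ tot n ℓ L j := by
  have hmod : (i : ℕ) % n ≤ (j : ℕ) % n := by
    have hi := Nat.div_add_mod (i : ℕ) n
    have hj := Nat.div_add_mod (j : ℕ) n
    rw [hdiv] at hi
    omega
  unfold tot
  simp only [hdiv]
  apply hL
  rw [Fin.mk_le_mk]
  omega

theorem tot_injective (n ℓ : ℕ) : Function.Injective (tot n ℓ) := by
  intro L M h
  funext a b
  have hb := b.isLt
  have hn : 0 < n := by omega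
  have hr : n - 1 - (b : ℕ) < n := by omega
  have hlt : n * (a : ℕ) + (n - 1 - b) < n * ℓ := by
    have : n * ((a : ℕ) + 1) ≤ n * ℓ := Nat.mul_le_mul_left n a.isLt
    rw [mul_add, mul_one] at this
    omega
  have hdiv : (n * (a : ℕ) + (n - 1 - b)) / n = a := by
    rw [Nat.mul_add_div hn, Nat.div_eq_of_lt hr, add_zero]
  have hmod : n - 1 - (n * (a : ℕ) + (n - 1 - b)) % n = b := by
    rw [Nat.mul_add_mod, Nat.mod_eq_of_lt hr]
    omega
  have key := congrFun h ⟨_, hlt⟩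
  simpa only [tot, hdiv, hmod] using key

/-- If `σ` moves only small values of `a` out of the initial segment below `t`, and only large
values into it, then it does not decrease the partial sum of `a` up to `t`. -/
theorem sum_initial_le_sum_initial_perm {N : ℕ} (a : Fin N → ℤ) (σ : Equiv.Perm (Fin N))
    (t : ℕ) (c : ℤ) (hout : ∀ i, (σ i : ℕ) < t → t ≤ (i : ℕ) → a (σ i) ≤ c)
    (hin : ∀ i, t ≤ (σ i : ℕ) → (i : ℕ) < t → c ≤ a (σ i)) :
    (∑ i : Fin N, if (i : ℕ) < t then a i else 0) ≤
      ∑ i : Fin N, if (i : ℕ) < t then a (σ i) else 0 := by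
  have hc := Equiv.sum_comp σ fun i : Fin N => if (i : ℕ) < t then c else 0
  rw [← Equiv.sum_comp σ fun i : Fin N => if (i : ℕ) < t then a i else 0]
  have hle : ∑ i : Fin N, ((if (σ i : ℕ) < t then a (σ i) else 0) + if (i : ℕ) < t then c else 0) ≤
      ∑ i : Fin N, ((if (i : ℕ) < t then a (σ i) else 0) + if (σ i : ℕ) < t then c else 0) := by
    refine Finset.sum_le_sum fun i _ => ?_
    have h₁ := hout i
    have h₂ := hin i
    split_ifs <;> grind
  rw [Finset.sum_add_distrib, Finset.sum_add_distrib] at hle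
  linarith

/-- Among all rearrangements within blocks, `tot` has the smallest partial sums. -/
theorem sum_initial_tot_le {n ℓ : ℕ} {L : Fin ℓ → Fin n → ℕ} (hL : ∀ i, IsPartitionFn n (L i))
    (σ : Equiv.Perm (Fin (n * ℓ))) (hσ : ∀ i, (σ i : ℕ) / n = (i : ℕ) / n) (t : ℕ) :
    (∑ i : Fin (n * ℓ), if (i : ℕ) < t then (tot n ℓ L i : ℤ) else 0) ≤
      ∑ i : Fin (n * ℓ), if (i : ℕ) < t then (tot n ℓ L (σ i) : ℤ) else 0 := by
  refine sum_initial_le_sum_initial_perm (fun i => (tot n ℓ L i : ℤ)) σ t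
    (if h : t < n * ℓ then (tot n ℓ L ⟨t, h⟩ : ℤ) else 0) ?_ ?_
  · intro i h₁ h₂
    rw [dif_pos (h₂.trans_lt i.isLt)]
    refine Nat.cast_le.2 (tot_le_tot hL h₁.le (le_antisymm (Nat.div_le_div_right h₁.le) ?_))
    exact (Nat.div_le_div_right h₂).trans_eq (hσ i).symm
  · intro i h₁ h₂
    rw [dif_pos (h₁.trans_lt (σ i).isLt)]
    refine Nat.cast_le.2 (tot_le_tot hL h₁ (le_antisymm (Nat.div_le_div_right h₁) ?_))
    exact (hσ i).trans_le (Nat.div_le_div_right h₂.le)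

/-
STATEMENT 6.  Fix ℓ > 1, n ≥ m ≥ 1.  Let λ⃗, μ⃗ ∈ 𝒫_{m,ℓ} with ‖λ⃗‖ = ‖μ⃗‖, and let
λ ∈ ℤ^{nℓ} agree with λ⃗^{tot} up to a permutation of coordinates within each block of
n consecutive coordinates (i.e. λ = λ⃗^{tot} ∘ σ for some block-preserving σ ∈ 𝔖).
If μ⃗^{tot} ∈ λ + ℤ^{nℓ}_+, then μ⃗ ⊴ λ⃗.
-/

theorem statement6 (n ℓ m : ℕ) (hℓ : 1 < ℓ) (hm : 1 ≤ m) (hmn : m ≤ n)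
    (L M : Fin ℓ → Fin n → ℕ)
    (hL : IsLPartition n ℓ m L) (hM : IsLPartition n ℓ m M)
    (hnorm : sortedDesc n ℓ L = sortedDesc n ℓ M)
    (σ : Equiv.Perm (Fin (n * ℓ)))
    (hσ : ∀ i : Fin (n * ℓ), ((σ i : Fin (n * ℓ)) : ℕ) / n = (i : ℕ) / n)
    (hdiff : (fun i => (tot n ℓ M i : ℤ) - (tot n ℓ L (σ i) : ℤ)) ∈ Zplus (n * ℓ)) :
    lhdEq n ℓ M L := by
  obtain ⟨-, hsum, hpart⟩ := hdiff
  by_cases hLM : M = L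
  · exact Or.inr hLM
  refine Or.inl (Or.inr ⟨hnorm.symm, fun h0 => hLM (tot_injective n ℓ ?_), ?_, fun t => ?_⟩)
  · funext i
    exact Nat.cast_injective (R := ℤ) (sub_eq_zero.1 (congrFun h0 i))
  · rw [Finset.sum_sub_distrib] at hsum ⊢
    rwa [Equiv.sum_comp σ fun i => (tot n ℓ L i : ℤ)] at hsum
  · have hsplit (f g : Fin (n * ℓ) → ℤ) :
        (∑ i : Fin (n * ℓ), if (i : ℕ) < t then f i - g i else 0) =
          (∑ i : Fin (n * ℓ), if (i : ℕ) < t then f i else 0) -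
            ∑ i : Fin (n * ℓ), if (i : ℕ) < t then g i else 0 := by
      rw [← Finset.sum_sub_distrib]
      refine Finset.sum_congr rfl fun i _ => ?_
      split_ifs <;> simp
    have ht := hpart t
    rw [hsplit] at ht ⊢
    linarith [sum_initial_tot_le hL.1 σ hσ t]
end
end

section
/- Let λ⃗, μ⃗ ∈ 𝒫_{m,ℓ}. If for every 1 ≤ i ≤ ℓ one has |μ^{(i)}| = |λ^{(i)}| and μ^{(i)} ≤ λ^{(i)} in the dominance order, then μ⃗ ⊴ λ⃗. -/
noncomputable section

/-
STATEMENT 8.  Fix ℓ > 1, n ≥ m ≥ 1.  Let λ⃗, μ⃗ ∈ 𝒫_{m,ℓ}.  If for every 1 ≤ i ≤ ℓ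
one has |μ^{(i)}| = |λ^{(i)}| and μ^{(i)} ≤ λ^{(i)} in the dominance order, then
μ⃗ ⊴ λ⃗.
-/

/-- Dominance order on partitions with at most n parts (via partial sums). -/
def domFinLE (n : ℕ) (f g : Fin n → ℕ) : Prop :=
  ∀ k : ℕ, (∑ j : Fin n, if (j : ℕ) < k then f j else 0) ≤
    ∑ j : Fin n, if (j : ℕ) < k then g j else 0

/-- For any threshold `t`, the sum of the first `k` entries is at most `k * t` plus the total
excess over `t`. -/
theorem List.sum_take_le_mul_add_sum_map_sub (l : List ℕ) (k t : ℕ) :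
    (l.take k).sum ≤ k * t + (l.map (· - t)).sum := by
  induction l generalizing k with
  | nil => simp
  | cons a l ih =>
    cases k with
    | zero => simp
    | succ k =>
      have := ih k
      simp only [List.take_succ_cons, List.sum_cons, List.map_cons, add_mul]
      omega

/-- For a weakly decreasing list, the threshold given by the `k`-th entry attains the bound of
`List.sum_take_le_mul_add_sum_map_sub`. -/
theorem List.mul_add_sum_map_sub_le_sum_take (l : List ℕ) (hl : l.Pairwise (· ≥ ·)) (k : ℕ) :
    k * l.getD k 0 + (l.map (· - l.getD k 0)).sum ≤ (l.take k).sum := by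
  induction l generalizing k with
  | nil => simp
  | cons a l ih =>
    rw [List.pairwise_cons] at hl
    cases k with
    | zero =>
      simp only [List.getD_cons_zero, zero_mul, zero_add, List.take_zero, List.sum_nil,
        nonpos_iff_eq_zero, List.sum_eq_zero_iff, List.mem_map, List.mem_cons]
      rintro x ⟨y, rfl | hy, rfl⟩
      · simp
      · exact Nat.sub_eq_zero_of_le (hl.1 y hy)
    | succ k =>
      have hk := ih hl.2 k
      have ha : l.getD k 0 ≤ a := by
        rcases lt_or_ge k l.length with h | h
        · rw [List.getD_eq_getElem _ _ h]
          exact hl.1 _ (List.getElem_mem h)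
        · rw [List.getD_eq_default _ _ h]
          exact Nat.zero_le a
      simp only [List.getD_cons_succ, List.take_succ_cons, List.sum_cons, List.map_cons, add_mul]
      omega

theorem domListLE_of_sum_map_sub_le {l₁ l₂ : List ℕ} (h₂ : l₂.Pairwise (· ≥ ·))
    (h : ∀ t, (l₁.map (· - t)).sum ≤ (l₂.map (· - t)).sum) : domListLE l₁ l₂ := fun k =>
  (l₁.sum_take_le_mul_add_sum_map_sub k _).trans <|
    (Nat.add_le_add_left (h _) _).trans (l₂.mul_add_sum_map_sub_le_sum_take h₂ k)

theorem sortedDesc_pairwise (n ℓ : ℕ) (L : Fin ℓ → Fin n → ℕ) :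
    (sortedDesc n ℓ L).Pairwise (· ≥ ·) := by
  rw [sortedDesc, List.pairwise_reverse]
  exact Multiset.pairwise_sort _ _

theorem sum_map_sortedDesc (n ℓ : ℕ) (L : Fin ℓ → Fin n → ℕ) (f : ℕ → ℕ) :
    ((sortedDesc n ℓ L).map f).sum = ∑ i, ∑ j, f (L i j) := by
  rw [sortedDesc, List.map_reverse, List.sum_reverse, ← Multiset.sum_coe, ← Multiset.map_coe,
    Multiset.sort_eq, Multiset.map_map, ← Fintype.sum_prod_type']
  rfl

/-- If a partition `f` is dominated by `g`, then its total excess over any threshold is at most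
that of `g`. -/
theorem domFinLE.sum_sub_le {n : ℕ} {f g : Fin n → ℕ} (h : domFinLE n f g)
    (hf : IsPartitionFn n f) (t : ℕ) : ∑ j, (f j - t) ≤ ∑ j, (g j - t) := by
  obtain ⟨k, hk⟩ : ∃ k : ℕ, ∀ j : Fin n, (j : ℕ) < k ↔ t < f j := by
    by_cases hex : ∃ k : ℕ, ∃ hk : k < n, f ⟨k, hk⟩ ≤ t
    · classical
      refine ⟨Nat.find hex, fun j => ⟨fun hj => ?_, fun hj => ?_⟩⟩
      · have := Nat.find_min hex hj
        push Not at this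
        exact this j.2
      · by_contra hle
        obtain ⟨hn, hfk⟩ := Nat.find_spec hex
        have := hf ⟨_, hn⟩ j (Fin.le_def.2 (not_lt.1 hle))
        omega
    · push Not at hex
      exact ⟨n, fun j => ⟨fun _ => hex j j.2, fun _ => j.2⟩⟩
  have h₁ : ∑ j, (f j - t) + ∑ j : Fin n, (if (j : ℕ) < k then t else 0) =
      ∑ j : Fin n, if (j : ℕ) < k then f j else 0 := by
    rw [← Finset.sum_add_distrib]
    refine Finset.sum_congr rfl fun j _ => ?_
    have := hk j
    split_ifs <;> omega
  have h₂ : (∑ j : Fin n, if (j : ℕ) < k then g j else 0) ≤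
      ∑ j, (g j - t) + ∑ j : Fin n, (if (j : ℕ) < k then t else 0) := by
    rw [← Finset.sum_add_distrib]
    refine Finset.sum_le_sum fun j _ => ?_
    split_ifs <;> omega
  have := h k
  omega

/-- The position in the concatenation `tot` of the `r`-th entry of the `q`-th block. -/
def blockEquiv (n ℓ : ℕ) : Fin ℓ × Fin n ≃ Fin (n * ℓ) :=
  finProdFinEquiv.trans (finCongr (mul_comm ℓ n))

theorem blockEquiv_val (n ℓ : ℕ) (q : Fin ℓ) (r : Fin n) :
    (blockEquiv n ℓ (q, r) : ℕ) = r + n * q := rfl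

theorem tot_blockEquiv (n ℓ : ℕ) (L : Fin ℓ → Fin n → ℕ) (q : Fin ℓ) (r : Fin n) :
    tot n ℓ L (blockEquiv n ℓ (q, r)) = L q r.rev := by
  have hn : 0 < n := r.pos
  have hdiv : ((r : ℕ) + n * q) / n = q := by
    rw [Nat.add_mul_div_left _ _ hn, Nat.div_eq_of_lt r.2, zero_add]
  have hmod : ((r : ℕ) + n * q) % n = r := by
    rw [Nat.add_mul_mod_self_left, Nat.mod_eq_of_lt r.2]
  unfold tot
  congr 1
  · congr 1
  · exact Fin.ext (by simp [blockEquiv_val, hmod, Fin.val_rev]; omega)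

theorem domFinLE.sum_rev_nonneg {n : ℕ} {f g : Fin n → ℕ} (h : domFinLE n f g)
    (hsum : ∑ j, f j = ∑ j, g j) (s t : ℕ) :
    0 ≤ ∑ r : Fin n, if (r : ℕ) + s < t then (f r.rev : ℤ) - g r.rev else 0 := by
  rw [← Equiv.sum_comp Fin.revPerm]
  simp only [Fin.revPerm_apply, Fin.rev_rev]
  have hk : (∑ j : Fin n, if (j : ℕ) < n - (t - s) then (f j : ℤ) else 0) ≤
      ∑ j : Fin n, if (j : ℕ) < n - (t - s) then (g j : ℤ) else 0 := by
    exact_mod_cast h (n - (t - s))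
  have hsum' : ∑ j, (f j : ℤ) = ∑ j, (g j : ℤ) := by exact_mod_cast hsum
  have heq : (∑ j : Fin n, if (j.rev : ℕ) + s < t then (f j : ℤ) - g j else 0) =
      (∑ j, (f j : ℤ) - ∑ j, (g j : ℤ)) -
        ((∑ j : Fin n, if (j : ℕ) < n - (t - s) then (f j : ℤ) else 0) -
          ∑ j : Fin n, if (j : ℕ) < n - (t - s) then (g j : ℤ) else 0) := by
    simp only [← Finset.sum_sub_distrib]
    refine Finset.sum_congr rfl fun j _ => ?_
    rw [Fin.val_rev]
    split_ifs <;> omega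
  rw [heq]
  linarith

theorem statement8 (n ℓ m : ℕ) (hℓ : 1 < ℓ) (hm : 1 ≤ m) (hmn : m ≤ n)
    (L M : Fin ℓ → Fin n → ℕ)
    (hL : IsLPartition n ℓ m L) (hM : IsLPartition n ℓ m M)
    (hsize : ∀ i, ∑ j, M i j = ∑ j, L i j)
    (hdom : ∀ i, domFinLE n (M i) (L i)) :
    lhdEq n ℓ M L := by
  by_cases hs : sortedDesc n ℓ M = sortedDesc n ℓ L
  · by_cases hML : M = L
    · exact Or.inr hML
    refine Or.inl (Or.inr ⟨hs, fun h0 => hML ?_, ?_, fun t => ?_⟩)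
    · refine tot_injective n ℓ (funext fun i => ?_)
      have := congrFun h0 i
      simp only [Pi.zero_apply] at this
      omega
    · rw [← Equiv.sum_comp (blockEquiv n ℓ), Fintype.sum_prod_type]
      refine Finset.sum_eq_zero fun q _ => ?_
      simp only [tot_blockEquiv]
      rw [← Equiv.sum_comp Fin.revPerm]
      simp only [Fin.revPerm_apply, Fin.rev_rev, Finset.sum_sub_distrib]
      exact sub_eq_zero.2 (by exact_mod_cast hsize q)
    · rw [← Equiv.sum_comp (blockEquiv n ℓ), Fintype.sum_prod_type]
      refine Finset.sum_nonneg fun q _ => ?_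
      simp only [tot_blockEquiv, blockEquiv_val]
      exact (hdom q).sum_rev_nonneg (hsize q) _ t
  · refine Or.inl (Or.inl ⟨domListLE_of_sum_map_sub_le (sortedDesc_pairwise n ℓ L) ?_, hs⟩)
    intro t
    rw [sum_map_sortedDesc, sum_map_sortedDesc]
    exact Finset.sum_le_sum fun i _ => (hdom i).sum_sub_le (hM.1 i) t
end
end
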